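/- arXiv:1807.09292 — 3 statements merged into one kernel-verified Lean document; each statement's English description precedes it below -/
import Mathlib

section
/- In the warden's whiteboard game with n numbers (n ≥ 1) and goal position g ∈ ℕ^n, the prisoner can reach the goal from a position x ∈ ℕ^n (i.e., there exists N with CanWin N x) if and only if there exists k ∈ {0, …, n−1} such that the cyclic rotation y of x defined by y_i = x_{(i+k) mod n} satisfies y_i ≤ g_i for all i ∈ {0, …, n−1}. -/
/-- One move: the rightmost entry is transferred to the far left, becoming `c`,
producing `(c, x₀, …, x_{n−2})`. -/
def shift {α : Type*} {n : ℕ} (c : α) (x : Fin n → α) : Fin n → α :=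
  fun i => if _h : (i : ℕ) = 0 then c
    else x ⟨(i : ℕ) - 1, lt_of_le_of_lt (Nat.sub_le _ _) i.isLt⟩

/-- `CanWin n hn g N x`: in the whiteboard game with goal `g`, the prisoner can force
the goal within `N` moves from position `x`.  It holds iff `x = g`, or `N ≥ 1` and both:
(i) for every warden choice `c < x_{n-1}`, `CanWin (N-1)` holds at `(c, x₀, …, x_{n−2})`, and
(ii) there is a prisoner choice `c ≥ x_{n-1}` with `CanWin (N-1)` at `(c, x₀, …, x_{n−2})`. -/
def CanWin (n : ℕ) (hn : 1 ≤ n) (g : Fin n → ℕ) : ℕ → (Fin n → ℕ) → Prop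
  | 0, x => x = g
  | N + 1, x => x = g ∨
      ((∀ c : ℕ, c < x ⟨n - 1, Nat.sub_lt hn Nat.one_pos⟩ →
          CanWin n hn g N (shift c x)) ∧
       ∃ c : ℕ, x ⟨n - 1, Nat.sub_lt hn Nat.one_pos⟩ ≤ c ∧
          CanWin n hn g N (shift c x))

/-- The cyclic rotation `y` of `x` given by `y i = x ((i + k) % n)`. -/
def rotate {α : Type*} {n : ℕ} (x : Fin n → α) (k : ℕ) : Fin n → α :=
  fun i => x ⟨((i : ℕ) + k) % n, Nat.mod_lt _ (Nat.zero_lt_of_lt i.isLt)⟩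

theorem rotate_zero {α : Type*} {n : ℕ} (x : Fin n → α) : rotate x 0 = x := by
  funext i
  simp [rotate, Nat.mod_eq_of_lt i.isLt]

theorem rotate_self {α : Type*} {n : ℕ} (x : Fin n → α) : rotate x n = x := by
  funext i
  simp [rotate, Nat.mod_eq_of_lt i.isLt]

theorem rotate_mod {α : Type*} {n : ℕ} (x : Fin n → α) (k : ℕ) :
    rotate x (k % n) = rotate x k := by
  funext i
  simp [rotate]

theorem rotate_rotate {α : Type*} {n : ℕ} (x : Fin n → α) (a b : ℕ) :
    rotate (rotate x a) b = rotate x (a + b) := by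
  funext i
  simp [rotate, add_assoc, add_comm b a]

theorem rotate_mono {α : Type*} [Preorder α] {n : ℕ} {x y : Fin n → α} (h : x ≤ y) (k : ℕ) :
    rotate x k ≤ rotate y k :=
  fun _ => h _

theorem rotate_succ_last {α : Type*} {n : ℕ} (z : Fin n → α) {k : ℕ} (hk : k < n)
    (hlast : n - 1 < n) : rotate z (k + 1) ⟨n - 1, hlast⟩ = z ⟨k, hk⟩ := by
  have h : (n - 1 + (k + 1)) % n = k := by
    rw [show n - 1 + (k + 1) = k + n by omega, Nat.add_mod_right, Nat.mod_eq_of_lt hk]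
  simp [rotate, h]

theorem shift_rotate_succ {α : Type*} {n : ℕ} (c : α) (z : Fin n → α) {k : ℕ} (hk : k < n) :
    shift c (rotate z (k + 1)) = rotate (Function.update z ⟨k, hk⟩ c) k := by
  funext i
  by_cases hi : (i : ℕ) = 0
  · simp [shift, rotate, hi, Nat.mod_eq_of_lt hk]
  · have hne : ((i : ℕ) + k) % n ≠ k := by
      have := i.isLt
      rcases lt_or_ge ((i : ℕ) + k) n with h | h
      · rw [Nat.mod_eq_of_lt h]
        omega
      · rw [Nat.mod_eq_sub_mod h, Nat.mod_eq_of_lt (by omega)]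
        omega
    have hidx : (i : ℕ) - 1 + (k + 1) = i + k := by omega
    simp [shift, rotate, hi, hidx, Function.update, hne]

theorem CanWin.succ {n : ℕ} {hn : 1 ≤ n} {g : Fin n → ℕ} {N : ℕ} {x : Fin n → ℕ}
    (h : CanWin n hn g N x) : CanWin n hn g (N + 1) x := by
  induction N generalizing x with
  | zero => exact Or.inl h
  | succ N ih =>
    rcases h with h | ⟨h, c, hc, hw⟩
    · exact Or.inl h
    · exact Or.inr ⟨fun c hc => ih (h c hc), c, hc, ih hw⟩

theorem CanWin.mono {n : ℕ} {hn : 1 ≤ n} {g : Fin n → ℕ} {M N : ℕ} {x : Fin n → ℕ}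
    (hMN : M ≤ N) (h : CanWin n hn g M x) : CanWin n hn g N x :=
  Nat.le_induction h (fun _ _ => CanWin.succ) N hMN

/-- A position of the form `rotate z (k + 1)` is winnable as soon as every reply of the warden and
some reply of the prisoner lead to winnable positions. -/
theorem exists_canWin_rotate_succ {n : ℕ} {hn : 1 ≤ n} {g z : Fin n → ℕ} {k : ℕ} (hk : k < n)
    (hwarden : ∀ c < z ⟨k, hk⟩,
      ∃ N, CanWin n hn g N (rotate (Function.update z ⟨k, hk⟩ c) k))
    (hprisoner : ∃ c ≥ z ⟨k, hk⟩,
      ∃ N, CanWin n hn g N (rotate (Function.update z ⟨k, hk⟩ c) k)) :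
    ∃ N, CanWin n hn g N (rotate z (k + 1)) := by
  choose! f hf using hwarden
  obtain ⟨c, hc, M, hM⟩ := hprisoner
  refine ⟨max M ((Finset.range (z ⟨k, hk⟩)).sup f) + 1, Or.inr ⟨fun d hd => ?_, c, ?_, ?_⟩⟩
  · rw [rotate_succ_last z hk] at hd
    rw [shift_rotate_succ d z hk]
    exact (hf d hd).mono
      (le_max_of_le_right (Finset.le_sup (f := f) (Finset.mem_range.2 hd)))
  · rwa [rotate_succ_last z hk]
  · rw [shift_rotate_succ c z hk]
    exact hM.mono (le_max_left _ _)

/-- By always restoring the erased number, the prisoner can finish a rotation without leaving a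
given lower set. -/
theorem exists_canWin_rotate_of_isLowerSet {n : ℕ} {hn : 1 ≤ n} {g : Fin n → ℕ}
    {S : Set (Fin n → ℕ)} (hS : IsLowerSet S) (hwin : ∀ z ∈ S, ∃ N, CanWin n hn g N z)
    {k : ℕ} (hk : k ≤ n) {z : Fin n → ℕ} (hz : z ∈ S) :
    ∃ N, CanWin n hn g N (rotate z k) := by
  induction k generalizing z with
  | zero => simpa only [rotate_zero] using hwin z hz
  | succ k ih =>
    refine exists_canWin_rotate_succ hk (fun c hc => ih (by omega) (hS ?_ hz))
      ⟨z ⟨k, hk⟩, le_rfl, ih (by omega) ?_⟩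
    · exact update_le_self_iff.2 hc.le
    · rwa [Function.update_eq_self]

/-- If the prisoner can win from every position below `g` that is lexicographically smaller than
`y`, then he can win while raising the entries of `y` one by one to those of `g`. -/
theorem exists_canWin_rotate_of_raised {n : ℕ} {hn : 1 ≤ n} {g y : Fin n → ℕ}
    (hwin : ∀ z, toLex z < toLex y → z ≤ g → ∃ N, CanWin n hn g N z)
    {k : ℕ} (hk : k ≤ n) {z : Fin n → ℕ} (hzg : z ≤ g)
    (hlt : ∀ i : Fin n, (i : ℕ) < k → z i = y i) (hge : ∀ i : Fin n, k ≤ (i : ℕ) → z i = g i) :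
    ∃ N, CanWin n hn g N (rotate z k) := by
  induction k generalizing z with
  | zero =>
    rw [rotate_zero]
    exact ⟨0, funext fun i => hge i (Nat.zero_le _)⟩
  | succ k ih =>
    refine exists_canWin_rotate_succ hk (fun c hc => ?_)
      ⟨g ⟨k, hk⟩, hzg _, ih (by omega) ?_ (fun i hi => ?_) (fun i hi => ?_)⟩
    · refine exists_canWin_rotate_of_isLowerSet (S := {w | toLex w < toLex y ∧ w ≤ g})
        (fun a b hba ha => ⟨(Pi.toLex_monotone hba).trans_lt ha.1, hba.trans ha.2⟩)
        (fun w hw => hwin w hw.1 hw.2) (by omega)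
        ⟨⟨⟨k, hk⟩, fun j hj => ?_, ?_⟩, (update_le_self_iff.2 hc.le).trans hzg⟩
      · have hj' : (j : ℕ) < k := hj
        simpa [Function.update_of_ne hj.ne] using hlt j (by omega)
      · simpa [← hlt ⟨k, hk⟩ (Nat.lt_succ_self k)] using hc
    · exact update_le_iff.2 ⟨le_rfl, fun j _ => hzg j⟩
    · rw [Function.update_of_ne (Fin.ne_of_val_ne hi.ne)]
      exact hlt i (by omega)
    · rcases eq_or_ne i ⟨k, hk⟩ with rfl | hne
      · simp
      · rw [Function.update_of_ne hne]
        have := Fin.val_ne_of_ne hne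
        exact hge i (by simp only at this; omega)

theorem exists_canWin_of_le {n : ℕ} {hn : 1 ≤ n} {g : Fin n → ℕ} (y : Fin n → ℕ) (hy : y ≤ g) :
    ∃ N, CanWin n hn g N y := by
  suffices h : ∀ l : Lex (Fin n → ℕ), ofLex l ≤ g → ∃ N, CanWin n hn g N (ofLex l) from
    h (toLex y) hy
  intro l
  induction l using WellFoundedLT.induction with
  | ind l ih =>
    intro hl
    simpa only [rotate_self] using exists_canWin_rotate_of_raised (y := ofLex l)
      (fun z hz hzg => ih (toLex z) hz hzg) le_rfl hl (fun _ _ => rfl)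
      (fun i hi => absurd i.isLt hi.not_gt)

theorem CanWin.exists_rotate_le {n : ℕ} {hn : 1 ≤ n} {g : Fin n → ℕ} {N : ℕ} {x : Fin n → ℕ}
    (h : CanWin n hn g N x) : ∃ k, rotate x k ≤ g := by
  induction N generalizing x with
  | zero => exact ⟨0, by rw [rotate_zero]; exact le_of_eq h⟩
  | succ N ih =>
    rcases h with h | ⟨-, c, hc, hw⟩
    · exact ⟨0, by rw [rotate_zero]; exact le_of_eq h⟩
    · obtain ⟨k, hk⟩ := ih hw
      have hlast : n - 1 < n := by omega
      have hshift : shift c x = rotate (Function.update x ⟨n - 1, hlast⟩ c) (n - 1) := by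
        rw [← shift_rotate_succ c x hlast, Nat.sub_add_cancel hn, rotate_self]
      rw [hshift, rotate_rotate] at hk
      exact ⟨_, (rotate_mono (le_update_self_iff.2 hc) _).trans hk⟩


/-- In the whiteboard game with goal `g`, the prisoner can reach the goal from `x`
iff some cyclic rotation `y` of `x`, given by `y i = x ((i + k) % n)`, satisfies
`y i ≤ g i` for all `i`. -/
theorem whiteboard_winnable_iff (n : ℕ) (hn : 1 ≤ n) (g x : Fin n → ℕ) :
    (∃ N : ℕ, CanWin n hn g N x) ↔
      ∃ k : ℕ, k < n ∧
        ∀ i : Fin n, x ⟨((i : ℕ) + k) % n, Nat.mod_lt _ hn⟩ ≤ g i := by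
  constructor
  · rintro ⟨N, hN⟩
    obtain ⟨k, hk⟩ := hN.exists_rotate_le
    rw [← rotate_mod] at hk
    exact ⟨k % n, Nat.mod_lt _ hn, hk⟩
  · rintro ⟨k, hk, h⟩
    have hx : rotate (rotate x k) (n - k) = x := by
      rw [rotate_rotate, Nat.add_sub_cancel' hk.le, rotate_self]
    rw [← hx]
    exact exists_canWin_rotate_of_isLowerSet (isLowerSet_Iic g) exists_canWin_of_le
      (Nat.sub_le n k) (Set.mem_Iic.2 h)
end

section
/- In the warden's whiteboard game with n numbers (n ≥ 1) and goal position g ∈ ℕ^n, if no cyclic rotation of the position x ∈ ℕ^n is coordinatewise at most g (i.e., for every k ∈ {0,…,n−1} there exists i with x_{(i+k) mod n} > g_i), then for every N, CanWin N x fails; that is, the warden can prevent the prisoner from ever reaching the goal. -/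
/-- If the new entry is at least the old rightmost one, a move dominates the cyclic rotation
by one place. -/
theorem le_shift_of_last_le {n : ℕ} (hn : 1 ≤ n) (x : Fin n → ℕ) {c : ℕ}
    (hc : x ⟨n - 1, Nat.sub_lt hn Nat.one_pos⟩ ≤ c) (j : Fin n) :
    x ⟨((j : ℕ) + (n - 1)) % n, Nat.mod_lt _ hn⟩ ≤ shift c x j := by
  unfold shift
  split_ifs with hj
  · refine le_of_eq_of_le ?_ hc
    congr 2
    rw [hj, Nat.zero_add, Nat.mod_eq_of_lt (by omega)]
  · refine le_of_eq ?_
    congr 2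
    rw [show (j : ℕ) + (n - 1) = (j - 1) + n by omega, Nat.add_mod_right,
      Nat.mod_eq_of_lt (by omega)]

/-- If no cyclic rotation of `x` is coordinatewise at most `g`, then the warden can
prevent the prisoner from ever reaching the goal: `CanWin N x` fails for every `N`. -/
theorem whiteboard_warden_blocks (n : ℕ) (hn : 1 ≤ n) (g x : Fin n → ℕ)
    (h : ∀ k : ℕ, k < n →
        ∃ i : Fin n, g i < x ⟨((i : ℕ) + k) % n, Nat.mod_lt _ hn⟩) :
    ∀ N : ℕ, ¬ CanWin n hn g N x := by
  intro N
  induction N generalizing x with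
  | zero =>
    rintro rfl
    obtain ⟨i, hi⟩ := h 0 hn
    simp [Nat.mod_eq_of_lt i.isLt] at hi
  | succ N ih =>
    rintro (rfl | ⟨-, c, hc, hwin⟩)
    · obtain ⟨i, hi⟩ := h 0 hn
      simp [Nat.mod_eq_of_lt i.isLt] at hi
    · refine ih (shift c x) (fun k _ => ?_) hwin
      obtain ⟨i, hi⟩ := h ((k + (n - 1)) % n) (Nat.mod_lt _ hn)
      refine ⟨i, hi.trans_le (le_of_eq_of_le ?_ (le_shift_of_last_le hn x hc _))⟩
      congr 2
      simp [Nat.add_assoc]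
end

section
/- In the warden's whiteboard game with n numbers (n ≥ 1) and goal position g ∈ ℕ^n, the remoteness function is injective on the set of winnable positions: if x and y are positions from each of which the prisoner can reach the goal, and r(x) = r(y), then x = y. -/
/-- The remoteness of a winnable position: the least `N` with `CanWin N x`. -/
noncomputable def remoteness (n : ℕ) (hn : 1 ≤ n) (g : Fin n → ℕ) (x : Fin n → ℕ) : ℕ :=
  sInf {N | CanWin n hn g N x}

/-- The prisoner can ensure that the next position after `x` lies in `S`. -/
def CanForceInto {m : ℕ} (S : Set (Fin (m + 1) → ℕ)) (x : Fin (m + 1) → ℕ) : Prop :=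
  (∀ c < x (Fin.last m), (Fin.cons c (Fin.init x) : Fin (m + 1) → ℕ) ∈ S) ∧
    ∃ c, x (Fin.last m) ≤ c ∧ (Fin.cons c (Fin.init x) : Fin (m + 1) → ℕ) ∈ S

theorem CanForceInto.mono {m : ℕ} {S T : Set (Fin (m + 1) → ℕ)} (h : S ⊆ T)
    {x : Fin (m + 1) → ℕ} (hx : CanForceInto S x) : CanForceInto T x :=
  ⟨fun c hc => h (hx.1 c hc), hx.2.imp fun _ hc => ⟨hc.1, h hc.2⟩⟩

theorem shift_eq_cons_init {m : ℕ} (c : ℕ) (x : Fin (m + 1) → ℕ) :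
    shift c x = Fin.cons c (Fin.init x) := by
  funext i
  refine Fin.cases ?_ (fun j => ?_) i
  · simp [shift]
  · simp only [shift, Fin.val_succ, Nat.add_eq_zero_iff, one_ne_zero, and_false, dite_false,
      Fin.cons_succ, Fin.init]
    congr 1

theorem canWin_succ_iff {m : ℕ} {hn : 1 ≤ m + 1} {g x : Fin (m + 1) → ℕ} {N : ℕ} :
    CanWin (m + 1) hn g (N + 1) x ↔
      x = g ∨ CanForceInto {y | CanWin (m + 1) hn g N y} x := by
  simp only [CanWin, shift_eq_cons_init, CanForceInto]
  rfl

theorem canWin_succ {m : ℕ} {hn : 1 ≤ m + 1} {g x : Fin (m + 1) → ℕ} {N : ℕ}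
    (h : CanWin (m + 1) hn g N x) : CanWin (m + 1) hn g (N + 1) x := by
  induction N generalizing x with
  | zero => exact Or.inl h
  | succ N ih =>
    rw [canWin_succ_iff] at h ⊢
    exact h.imp_right (CanForceInto.mono fun _ => ih)

/-- Among the positions with a given initial segment `t`, there are at most as many that can be
forced into `S` as there are elements of `S` with final segment `t`. -/
theorem card_le_of_canForceInto {m : ℕ} {S F : Finset (Fin (m + 1) → ℕ)} {t : Fin m → ℕ}
    (hF : ∀ x ∈ F, Fin.init x = t ∧ CanForceInto (S : Set (Fin (m + 1) → ℕ)) x) :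
    F.card ≤ (S.filter fun y => Fin.tail y = t).card := by
  rcases F.eq_empty_or_nonempty with rfl | hne
  · simp
  obtain ⟨z, hz, hmax⟩ := F.exists_max_image (fun x => x (Fin.last m)) hne
  obtain ⟨rfl, hlt, d, hd, hdS⟩ := hF z hz
  calc F.card
      ≤ (Finset.range (z (Fin.last m) + 1)).card := by
        refine Finset.card_le_card_of_injOn (fun x => x (Fin.last m)) ?_ ?_
        · intro x hx
          simpa [Nat.lt_succ_iff] using hmax x hx
        · intro x hx y hy hxy
          rw [← Fin.snoc_init_self x, ← Fin.snoc_init_self y, (hF x hx).1, (hF y hy).1]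
          exact congrArg _ hxy
    _ = (insert d (Finset.range (z (Fin.last m)))).card := by
        rw [Finset.card_insert_of_notMem (by simpa using hd)]
        simp
    _ ≤ _ := by
        refine Finset.card_le_card_of_injOn
          (fun c => (Fin.cons c (Fin.init z) : Fin (m + 1) → ℕ)) ?_ ?_
        · intro c hc
          simp only [Finset.coe_insert, Set.mem_insert_iff, Finset.mem_coe,
            Finset.mem_range] at hc
          rcases hc with rfl | hc
          · simpa using hdS
          · simpa using hlt c hc
        · intro a _ b _ hab
          exact Fin.cons_left_injective (α := fun _ => ℕ) _ hab

/-- Regarding each element of `S` as an edge from its initial to its final segment, the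
in-degrees and out-degrees are those of a trail starting with the edge `g` and ending at the
vertex `e`. -/
def IsBalanced {m : ℕ} (g : Fin (m + 1) → ℕ) (S : Finset (Fin (m + 1) → ℕ)) (e : Fin m → ℕ) :
    Prop :=
  ∀ t, (S.filter fun y => Fin.tail y = t).card + (if Fin.init g = t then 1 else 0) =
    (S.filter fun y => Fin.init y = t).card + (if e = t then 1 else 0)

theorem isBalanced_singleton {m : ℕ} (g : Fin (m + 1) → ℕ) :
    IsBalanced g {g} (Fin.tail g) := by
  intro t
  simp only [Finset.filter_singleton]
  split_ifs <;> simp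

theorem IsBalanced.insert {m : ℕ} {g x : Fin (m + 1) → ℕ} {S : Finset (Fin (m + 1) → ℕ)}
    (h : IsBalanced g S (Fin.init x)) (hx : x ∉ S) :
    IsBalanced g (insert x S) (Fin.tail x) := by
  intro t
  have ht := h t
  simp only [Finset.filter_insert]
  split_ifs at ht ⊢ <;> simp [hx] <;> omega

/-- If `S` is balanced, at most one new position can be forced into it with a given initial
segment, and only if that segment is the end of the trail. -/
theorem IsBalanced.card_new_le {m : ℕ} {g : Fin (m + 1) → ℕ} {S D : Finset (Fin (m + 1) → ℕ)}
    {e t : Fin m → ℕ} (h : IsBalanced g S e) (hg : g ∈ S)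
    (hS : ∀ x ∈ S, x = g ∨ CanForceInto (S : Set (Fin (m + 1) → ℕ)) x)
    (hD : ∀ x ∈ D, x ∉ S ∧ Fin.init x = t ∧ CanForceInto (S : Set (Fin (m + 1) → ℕ)) x) :
    D.card ≤ if e = t then 1 else 0 := by
  have hdisj : Disjoint D ((S.filter fun y => Fin.init y = t).erase g) := by
    rw [Finset.disjoint_left]
    intro x hx hx'
    exact (hD x hx).1 (Finset.mem_filter.1 (Finset.mem_of_mem_erase hx')).1
  have hle : (D ∪ (S.filter fun y => Fin.init y = t).erase g).card ≤
      (S.filter fun y => Fin.tail y = t).card := by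
    refine card_le_of_canForceInto fun x hx => ?_
    rcases Finset.mem_union.1 hx with hx | hx
    · exact (hD x hx).2
    · obtain ⟨hne, hx⟩ := Finset.mem_erase.1 hx
      obtain ⟨hxS, hxt⟩ := Finset.mem_filter.1 hx
      exact ⟨hxt, (hS x hxS).resolve_left hne⟩
  rw [Finset.card_union_of_disjoint hdisj, Finset.card_erase_eq_ite] at hle
  have ht := h t
  simp only [Finset.mem_filter, hg, true_and] at hle
  split_ifs at hle ht ⊢ <;> omega

/-- A finite set of positions winnable within `N` moves, balanced as a trail, admits at most one
new position winnable within `N + 1` moves, starting at the end of the trail. -/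
theorem IsBalanced.new_canWin {m : ℕ} {hn : 1 ≤ m + 1} {g : Fin (m + 1) → ℕ} {N : ℕ}
    {S : Finset (Fin (m + 1) → ℕ)} {e : Fin m → ℕ} (h : IsBalanced g S e)
    (hS : ∀ x, x ∈ S ↔ CanWin (m + 1) hn g N x) :
    (∀ x, CanWin (m + 1) hn g (N + 1) x → x ∉ S → Fin.init x = e) ∧
      ∀ x y, CanWin (m + 1) hn g (N + 1) x → x ∉ S →
        CanWin (m + 1) hn g (N + 1) y → y ∉ S → x = y := by
  have hset : {y | CanWin (m + 1) hn g N y} = (S : Set (Fin (m + 1) → ℕ)) := by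
    ext y
    simp [hS]
  have hforce : ∀ x, CanWin (m + 1) hn g (N + 1) x →
      x = g ∨ CanForceInto (S : Set (Fin (m + 1) → ℕ)) x := by
    intro x hx
    rwa [canWin_succ_iff, hset] at hx
  have hg : g ∈ S := by
    rw [hS]
    cases N with
    | zero => rfl
    | succ N => exact Or.inl rfl
  have hold : ∀ x ∈ S, x = g ∨ CanForceInto (S : Set (Fin (m + 1) → ℕ)) x :=
    fun x hx => hforce x (canWin_succ ((hS x).1 hx))
  have hnew : ∀ x, CanWin (m + 1) hn g (N + 1) x → x ∉ S →
      CanForceInto (S : Set (Fin (m + 1) → ℕ)) x :=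
    fun x hx hxS => (hforce x hx).resolve_left fun hxg => hxS (hxg ▸ hg)
  have hinit : ∀ x, CanWin (m + 1) hn g (N + 1) x → x ∉ S → Fin.init x = e := by
    intro x hx hxS
    by_contra hne
    have hcard := h.card_new_le (D := {x}) (t := Fin.init x) hg hold
      (by simpa using ⟨hxS, hnew x hx hxS⟩)
    simp [Ne.symm hne] at hcard
  refine ⟨hinit, fun x y hx hxS hy hyS => ?_⟩
  by_contra hne
  have hcard := h.card_new_le (D := {x, y}) (t := e) hg hold (by
    intro z hz
    rcases Finset.mem_insert.1 hz with rfl | hz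
    · exact ⟨hxS, hinit z hx hxS, hnew z hx hxS⟩
    · obtain rfl := Finset.mem_singleton.1 hz
      exact ⟨hyS, hinit z hy hyS, hnew z hy hyS⟩)
  simp [Finset.card_pair hne] at hcard

theorem exists_isBalanced_canWin {m : ℕ} (hn : 1 ≤ m + 1) (g : Fin (m + 1) → ℕ) (N : ℕ) :
    ∃ S e, IsBalanced g S e ∧ ∀ x, x ∈ S ↔ CanWin (m + 1) hn g N x := by
  induction N with
  | zero => exact ⟨{g}, Fin.tail g, isBalanced_singleton g, fun x => by simp [CanWin]⟩
  | succ N ih =>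
    obtain ⟨S, e, hbal, hS⟩ := ih
    obtain ⟨hinit, huniq⟩ := hbal.new_canWin hS
    have hsub : ∀ x ∈ S, CanWin (m + 1) hn g (N + 1) x := fun x hx => canWin_succ ((hS x).1 hx)
    by_cases hex : ∃ x, CanWin (m + 1) hn g (N + 1) x ∧ x ∉ S
    · obtain ⟨x, hx, hxS⟩ := hex
      obtain rfl := hinit x hx hxS
      refine ⟨insert x S, Fin.tail x, hbal.insert hxS, fun y => ?_⟩
      rw [Finset.mem_insert]
      refine ⟨?_, fun hy => or_iff_not_imp_right.2 fun hyS => huniq y x hy hyS hx hxS⟩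
      rintro (rfl | hy)
      exacts [hx, hsub y hy]
    · push Not at hex
      exact ⟨S, e, hbal, fun x => ⟨hsub x, hex x⟩⟩

/-- The remoteness function is injective on winnable positions: two winnable
positions with the same remoteness are equal. -/
theorem whiteboard_remoteness_injective (n : ℕ) (hn : 1 ≤ n) (g : Fin n → ℕ)
    (x y : Fin n → ℕ) (hx : ∃ N : ℕ, CanWin n hn g N x) (hy : ∃ N : ℕ, CanWin n hn g N y)
    (h : remoteness n hn g x = remoteness n hn g y) : x = y := by
  obtain ⟨m, rfl⟩ : ∃ m, n = m + 1 := ⟨n - 1, by omega⟩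
  have hxr : CanWin (m + 1) hn g (remoteness (m + 1) hn g x) x := Nat.sInf_mem hx
  have hyr : CanWin (m + 1) hn g (remoteness (m + 1) hn g y) y := Nat.sInf_mem hy
  have hxm : ∀ N < remoteness (m + 1) hn g x, ¬ CanWin (m + 1) hn g N x :=
    fun N hN => Nat.notMem_of_lt_sInf hN
  have hym : ∀ N < remoteness (m + 1) hn g y, ¬ CanWin (m + 1) hn g N y :=
    fun N hN => Nat.notMem_of_lt_sInf hN
  rw [← h] at hyr hym
  generalize remoteness (m + 1) hn g x = r at hxr hyr hxm hym
  cases r with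
  | zero => exact Eq.trans hxr (Eq.symm hyr)
  | succ N =>
    obtain ⟨S, e, hbal, hS⟩ := exists_isBalanced_canWin hn g N
    refine (hbal.new_canWin hS).2 x y hxr ?_ hyr ?_
    · exact fun hxS => hxm N N.lt_succ_self ((hS x).1 hxS)
    · exact fun hyS => hym N N.lt_succ_self ((hS y).1 hyS)
end
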